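/- arXiv:1212.4329 — 2 statements merged into one kernel-verified Lean document; each statement's English description precedes it below -/
import Mathlib

section
/- Let 𝓕_Leb denote the family of all Lebesgue-measurable subsets of ℂ of positive Lebesgue measure. The set SES(ℂ, 𝓕_Leb) \ PES(ℂ) is strongly 2^𝔠-algebrable in the algebra ℂ^ℂ, where 𝔠 is the cardinality of the continuum. -/
open Cardinal

/-- A subset `E` of a commutative `K`-algebra `A` is strongly `lam`-algebrable: `E ∪ {0}`
contains a free commutative `K`-algebra with `lam` free generators; concretely, there is an
injective family of `lam` elements of `E` such that every nonzero polynomial over `K` without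
constant term, evaluated at distinct members of the family, is nonzero and belongs to `E`. -/
def StronglyAlgebrable (K : Type) {A : Type} [CommRing K] [CommRing A] [Algebra K A]
    (E : Set A) (lam : Cardinal) : Prop :=
  ∃ (ι : Type) (x : ι → A), #ι = lam ∧ Function.Injective x ∧
    (∀ i, x i ∈ E) ∧
    ∀ n : ℕ, 0 < n → ∀ P : MvPolynomial (Fin n) K, P ≠ 0 →
      MvPolynomial.constantCoeff P = 0 →
      ∀ ξ : Fin n → ι, Function.Injective ξ →
        MvPolynomial.aeval (fun i => x (ξ i)) P ≠ 0 ∧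
        MvPolynomial.aeval (fun i => x (ξ i)) P ∈ E

/-- `f ∈ SES(ℂ, 𝓕)`: for every `F ∈ 𝓕` there are `n ≥ 1` and a complex polynomial `P` in
`n` variables with `f(F) = P(ℂⁿ)`, and each fiber of `f` over a point of `f(F)`, intersected
with `F`, has cardinality `𝔠`. -/
def SESC (𝓕 : Set (Set ℂ)) : Set (ℂ → ℂ) :=
  {f | ∀ F ∈ 𝓕,
    (∃ n : ℕ, 0 < n ∧ ∃ P : MvPolynomial (Fin n) ℂ,
      f '' F = Set.range fun t : Fin n → ℂ => MvPolynomial.eval t P) ∧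
    ∀ y ∈ f '' F, #{x : ℂ | x ∈ F ∧ f x = y} = Cardinal.continuum}

/-- The family of Lebesgue-measurable subsets of `ℂ` of positive Lebesgue measure
(Lebesgue measurability = null-measurability with respect to the volume measure). -/
def LebFamily : Set (Set ℂ) :=
  {A | MeasureTheory.NullMeasurableSet A ∧ 0 < MeasureTheory.volume A}

/-- `f ∈ PES(ℂ)`: `f` maps every nonempty perfect subset of `ℂ` onto `ℂ`. -/
def PES : Set (ℂ → ℂ) :=
  {f | ∀ P : Set ℂ, Perfect P → P.Nonempty → f '' P = Set.univ}

/-- A family of sets, each at least as large as the index type, has an injective choice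
function. -/
theorem exists_injective_forall_mem_of_mk_le {ι α : Type} (A : ι → Set α)
    (hA : ∀ i, #ι ≤ #(A i)) : ∃ x : ι → α, Function.Injective x ∧ ∀ i, x i ∈ A i := by
  obtain ⟨_, _, hι⟩ := exists_ord_eq_type_lt ι
  have key : ∀ (i : ι) (y : Set.Iio i → α), ∃ a ∈ A i, a ∉ Set.range y := by
    intro i y
    by_contra! h
    have hle : #(A i) ≤ #(Set.Iio i) := (mk_le_mk_of_subset h).trans mk_range_le
    exact absurd (mk_Iio_lt i hι) (not_lt.2 ((hA i).trans hle))
  choose c hcA hcr using key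
  let x : ι → α := WellFounded.fix (wellFounded_lt (α := ι)) fun i y => c i fun j => y j j.2
  have hx : ∀ i, x i = c i fun j => x j := fun i => WellFounded.fix_eq _ _ i
  have hne : ∀ i j, j < i → x j ≠ x i := by
    intro i j hji h
    rw [hx i] at h
    exact hcr i (fun j => x j) ⟨⟨j, hji⟩, h⟩
  refine ⟨x, fun i j hij => ?_, fun i => ?_⟩
  · rcases lt_trichotomy i j with h | h | h
    · exact absurd hij (hne _ _ h)
    · exact h
    · exact absurd hij.symm (hne _ _ h)
  · rw [hx i]
    exact hcA _ _

/-- If a family of at most `𝔠` sets consists of sets of cardinality at least `𝔠`, then some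
function to `T`, where `#T = 𝔠`, maps each of them onto `T`. -/
theorem exists_forall_image_eq_univ_of_mk_le_continuum {α T : Type} (hT : #T = 𝔠)
    (𝓚 : Set (Set α)) (h𝓚 : #𝓚 ≤ 𝔠) (hcard : ∀ K ∈ 𝓚, 𝔠 ≤ #K) :
    ∃ h : α → T, ∀ K ∈ 𝓚, h '' K = Set.univ := by
  have hle : #(𝓚 × T) ≤ 𝔠 := by
    rw [mk_prod, lift_id, lift_id, hT]
    exact (mul_le_mul_left h𝓚 _).trans continuum_mul_self.le
  obtain ⟨x, hxi, hx⟩ := exists_injective_forall_mem_of_mk_le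
    (fun p : 𝓚 × T => (p.1 : Set α)) fun p => hle.trans (hcard _ p.1.2)
  have : Nonempty T := mk_ne_zero_iff.1 (hT ▸ continuum_ne_zero)
  refine ⟨Function.extend x Prod.snd fun _ => Classical.arbitrary T, fun K hK => ?_⟩
  refine Set.eq_univ_of_forall fun t => ⟨x (⟨K, hK⟩, t), hx (⟨K, hK⟩, t), ?_⟩
  rw [hxi.extend_apply]

/-- An uncountable measurable set in a standard Borel space has at least `𝔠` elements. -/
theorem MeasurableSet.continuum_le_mk_of_not_countable {α : Type} [MeasurableSpace α]
    [StandardBorelSpace α] {s : Set α} (hs : MeasurableSet s) (h : ¬ s.Countable) : 𝔠 ≤ #s := by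
  have := hs.standardBorel
  have e := PolishSpace.measurableEquivNatBoolOfNotCountable
    (α := s) (by rwa [Set.countable_coe_iff])
  rw [mk_congr e.toEquiv]
  simp

/-- There is a function on `ℂ`, with values in any prescribed type of cardinality `𝔠`, each
fiber of which meets every measurable set of positive measure in exactly `𝔠` points. -/
theorem exists_forall_mk_fiber_inter_eq_continuum {S : Type} (hS : #S = 𝔠) :
    ∃ h : ℂ → S, ∀ F ∈ LebFamily, ∀ s, #{z : ℂ | z ∈ F ∧ h z = s} = 𝔠 := by
  let 𝓚 : Set (Set ℂ) := {K | MeasurableSet K ∧ 0 < MeasureTheory.volume K}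
  have h𝓚 : #𝓚 ≤ 𝔠 := by
    have hgen := MeasurableSpace.cardinal_measurableSet_le_continuum
      ((MeasurableSpace.countable_countableGeneratingSet (α := ℂ)).le_aleph0.trans
        aleph0_le_continuum)
    rw [MeasurableSpace.generateFrom_countableGeneratingSet] at hgen
    exact (mk_le_mk_of_subset fun K hK => hK.1).trans hgen
  have hSS : #(S × S) = 𝔠 := by
    rw [mk_prod, lift_id, hS, continuum_mul_self]
  obtain ⟨h, hh⟩ := exists_forall_image_eq_univ_of_mk_le_continuum hSS 𝓚 h𝓚 fun K hK =>
    hK.1.continuum_le_mk_of_not_countable fun hc => hK.2.ne' (hc.measure_zero _)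
  refine ⟨fun z => (h z).1, fun F hF s => le_antisymm ?_ ?_⟩
  · exact (mk_set_le _).trans mk_complex.le
  · obtain ⟨K, hKF, hK, hae⟩ := hF.1.exists_measurable_subset_ae_eq
    have himg := hh K ⟨hK, by rw [MeasureTheory.measure_congr hae]; exact hF.2⟩
    have hsurj : Function.Surjective
        fun z : {z : ℂ | z ∈ F ∧ (h z).1 = s} => (h z).2 := by
      intro t
      obtain ⟨z, hz, hzt⟩ := himg.symm ▸ Set.mem_univ (s, t)
      exact ⟨⟨z, hKF hz, by rw [hzt]⟩, by simp [hzt]⟩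
    exact hS ▸ mk_le_of_surjective hsurj

open Classical in
/-- The function attached to `X` in the Fichtenholz–Kantorovich–Hausdorff independent family:
it sends `(A, φ)` to `φ (A ∩ X)`. -/
noncomputable def independentFamily {α : Type} (X : Set α)
    (p : Finset α × (Finset α →₀ ℂ)) : ℂ :=
  p.2 {a ∈ p.1 | a ∈ X}

/-- Finitely many distinct members of the independent family take arbitrary prescribed values
simultaneously. -/
theorem exists_independentFamily_eq {α : Type} {n : ℕ} {ξ : Fin n → Set α}
    (hξ : Function.Injective ξ) (t : Fin n → ℂ) :
    ∃ p, ∀ k, independentFamily (ξ k) p = t k := by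
  classical
  have hsep : ∀ i j, ∃ A : Finset α, i ≠ j → ∃ a ∈ A, ¬ (a ∈ ξ i ↔ a ∈ ξ j) := by
    intro i j
    by_cases hij : i = j
    · exact ⟨∅, fun h => absurd hij h⟩
    · have hne : ξ i ≠ ξ j := fun h => hij (hξ h)
      obtain ⟨a, ha⟩ : ∃ a, ¬ (a ∈ ξ i ↔ a ∈ ξ j) := by
        by_contra! h
        exact hne (Set.ext h)
      exact ⟨{a}, fun _ => ⟨a, Finset.mem_singleton_self a, ha⟩⟩
  choose A hA using hsep
  let B : Finset α := Finset.univ.biUnion fun i => Finset.univ.biUnion fun j => A i j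
  have hinj : Function.Injective fun k => {a ∈ B | a ∈ ξ k} := by
    intro i j hij
    by_contra hne
    obtain ⟨a, ha, hna⟩ := hA i j hne
    have haB : a ∈ B := Finset.mem_biUnion.2
      ⟨i, Finset.mem_univ _, Finset.mem_biUnion.2 ⟨j, Finset.mem_univ _, ha⟩⟩
    have := Finset.ext_iff.1 hij a
    simp only [Finset.mem_filter, haB, true_and] at this
    exact hna this
  refine ⟨(B, (Finsupp.equivFunOnFinite.symm t).mapDomain fun k => {a ∈ B | a ∈ ξ k}),
    fun k => ?_⟩
  have := Finsupp.mapDomain_apply hinj (Finsupp.equivFunOnFinite.symm t) k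
  simpa [independentFamily] using this

/-- The real axis, as a subset of `ℂ`, is a null set. -/
theorem volume_setOf_im_eq_zero : MeasureTheory.volume {z : ℂ | z.im = 0} = 0 := by
  have h : LinearMap.ker Complex.imLm ≠ ⊤ := by
    intro h
    have : Complex.I ∈ LinearMap.ker Complex.imLm := h ▸ Submodule.mem_top
    simp at this
  exact MeasureTheory.Measure.addHaar_submodule MeasureTheory.volume _ h

/-- The real axis is a perfect subset of `ℂ`. -/
theorem perfect_setOf_im_eq_zero : Perfect {z : ℂ | z.im = 0} := by
  refine ⟨isClosed_eq Complex.continuous_im continuous_const, ?_⟩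
  rw [preperfect_iff_nhds]
  intro z hz U hU
  obtain ⟨ε, hε, hsub⟩ := Metric.mem_nhds_iff.1 hU
  refine ⟨z + (ε / 2 : ℝ), ⟨hsub ?_, ?_⟩, ?_⟩
  · simp only [Metric.mem_ball, dist_self_add_left, Complex.norm_real, Real.norm_eq_abs]
    rw [abs_of_pos (by positivity)]
    linarith
  · simpa using hz
  · simp [hε.ne']

/-- `SES(ℂ, 𝓕_Leb) \ PES(ℂ)` is strongly `2 ^ 𝔠`-algebrable in `ℂ^ℂ`. -/
theorem stmt11 :
    StronglyAlgebrable ℂ (SESC LebFamily \ PES) ((2 : Cardinal) ^ Cardinal.continuum) := by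
  have hS : #(Finset ℝ × (Finset ℝ →₀ ℂ)) = 𝔠 := by simp [mk_real, mk_complex, continuum_mul_self]
  obtain ⟨h, hh⟩ := exists_forall_mk_fiber_inter_eq_continuum hS
  let f : Set ℝ → ℂ → ℂ := fun X z => if z.im = 0 then 0 else independentFamily X (h z)
  have hLeb : ∀ F ∈ LebFamily, F \ {z : ℂ | z.im = 0} ∈ LebFamily := by
    intro F hF
    refine ⟨hF.1.diff (MeasureTheory.NullMeasurableSet.of_null volume_setOf_im_eq_zero), ?_⟩
    rw [MeasureTheory.measure_sdiff_null volume_setOf_im_eq_zero]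
    exact hF.2
  have haeval : ∀ {n : ℕ} (P : MvPolynomial (Fin n) ℂ) (ξ : Fin n → Set ℝ) (z : ℂ),
      MvPolynomial.aeval (fun i => f (ξ i)) P z = MvPolynomial.eval (fun i => f (ξ i) z) P := by
    intro n P ξ z
    have := MvPolynomial.map_aeval (fun i => f (ξ i)) (Pi.evalRingHom (fun _ : ℂ => ℂ) z) P
    simp only [Pi.evalRingHom_apply] at this
    rw [this, MvPolynomial.eval, MvPolynomial.coe_eval₂Hom, MvPolynomial.coe_eval₂Hom]
    rfl
  have hfiber : ∀ {n : ℕ} (P : MvPolynomial (Fin n) ℂ) (ξ : Fin n → Set ℝ),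
      Function.Injective ξ → ∀ F ∈ LebFamily, ∀ t : Fin n → ℂ,
      #{z : ℂ | z ∈ F ∧ MvPolynomial.aeval (fun i => f (ξ i)) P z = MvPolynomial.eval t P}
        = 𝔠 := by
    intro n P ξ hξ F hF t
    refine le_antisymm ((mk_set_le _).trans mk_complex.le) ?_
    obtain ⟨p, hp⟩ := exists_independentFamily_eq hξ t
    rw [← hh _ (hLeb F hF) p]
    refine mk_le_mk_of_subset fun z hz => ⟨hz.1.1, ?_⟩
    have him : z.im ≠ 0 := hz.1.2
    have hval : (fun i => f (ξ i) z) = t := by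
      funext i
      simp [f, him, hz.2, hp]
    rw [haeval, hval]
  have himage : ∀ {n : ℕ} (P : MvPolynomial (Fin n) ℂ) (ξ : Fin n → Set ℝ),
      Function.Injective ξ → ∀ F ∈ LebFamily,
      MvPolynomial.aeval (fun i => f (ξ i)) P '' F =
        Set.range fun t : Fin n → ℂ => MvPolynomial.eval t P := by
    intro n P ξ hξ F hF
    apply subset_antisymm
    · rintro _ ⟨z, -, rfl⟩
      exact ⟨_, (haeval P ξ z).symm⟩
    · rintro _ ⟨t, rfl⟩
      obtain ⟨⟨z, hz⟩⟩ := mk_ne_zero_iff.1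
        (hfiber P ξ hξ F hF t ▸ continuum_ne_zero)
      exact ⟨z, hz.1, hz.2⟩
  have hmem : ∀ n : ℕ, 0 < n → ∀ P : MvPolynomial (Fin n) ℂ, P ≠ 0 →
      MvPolynomial.constantCoeff P = 0 → ∀ ξ : Fin n → Set ℝ, Function.Injective ξ →
        MvPolynomial.aeval (fun i => f (ξ i)) P ≠ 0 ∧
        MvPolynomial.aeval (fun i => f (ξ i)) P ∈ SESC LebFamily \ PES := by
    intro n hn P hP hP0 ξ hξ
    refine ⟨fun hzero => hP (MvPolynomial.funext fun t => ?_), fun F hF =>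
      ⟨⟨n, hn, P, himage P ξ hξ F hF⟩, fun y hy => ?_⟩, fun hPES => ?_⟩
    · have huniv : (Set.univ : Set ℂ) ∈ LebFamily :=
        ⟨MeasureTheory.nullMeasurableSet_univ, by simp⟩
      obtain ⟨z, -, hz⟩ := (himage P ξ hξ _ huniv).symm ▸ Set.mem_range_self t
      simpa [hzero] using hz.symm
    · rw [himage P ξ hξ F hF] at hy
      obtain ⟨t, rfl⟩ := hy
      exact hfiber P ξ hξ F hF t
    · obtain ⟨z, hz, h1⟩ := (hPES _ perfect_setOf_im_eq_zero ⟨0, by simp⟩).symm ▸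
        Set.mem_univ (1 : ℂ)
      have hz0 : (fun i => f (ξ i) z) = 0 := by
        funext i
        exact if_pos hz
      rw [haeval, hz0, MvPolynomial.eval_zero, hP0] at h1
      exact zero_ne_one h1
  have hsingle : ∀ X, f X ∈ SESC LebFamily \ PES := fun X => by
    simpa using (hmem 1 one_pos (MvPolynomial.X 0) (MvPolynomial.X_ne_zero 0) (by simp)
      (fun _ => X) (Function.injective_of_subsingleton _)).2
  refine ⟨Set ℝ, f, by simp [mk_real], fun X Y hXY => ?_, hsingle, hmem⟩
  by_contra hne
  have hξ : Function.Injective ![X, Y] := by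
    intro i j hij
    fin_cases i <;> fin_cases j <;> simp [hne, Ne.symm hne] at hij ⊢
  refine (hmem 2 two_pos (MvPolynomial.X 0 - MvPolynomial.X 1) ?_ (by simp) _ hξ).1 ?_
  · rw [sub_ne_zero]
    exact fun h => absurd (MvPolynomial.X_injective h) (by decide)
  · simp [hXY]
end

section
/- Let 𝓖 be the set of all functions f : ℂ → ℂ satisfying: (a) f is strongly everywhere surjective; (b) for every nonempty perfect set S ⊆ ℂ there is a nonempty perfect set S' ⊆ S such that f vanishes identically on S'; and (c) f is Lebesgue measurable and f has the Baire property (the preimage under f of every open set has the Baire property). Then 𝓖 is strongly 2^𝔠-algebrable in the algebra ℂ^ℂ, where 𝔠 is the cardinality of the continuum. -/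
open Cardinal

/-- A set has the Baire property if it differs from some open set by a meager set. -/
def HasBaireProperty {α : Type} [TopologicalSpace α] (s : Set α) : Prop :=
  ∃ u : Set α, IsOpen u ∧ IsMeagre (symmDiff s u)

/-- The family of subsets of `ℂ` which have the Baire property and are non-meager. -/
def BaireFamily : Set (Set ℂ) :=
  {A | HasBaireProperty A ∧ ¬ IsMeagre A}

/-- `f` is strongly everywhere surjective: on every nonempty open subset of `ℂ`, `f` takes
every complex value `𝔠` many times. -/
def SES : Set (ℂ → ℂ) :=
  {f | ∀ U : Set ℂ, IsOpen U → U.Nonempty → ∀ z : ℂ,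
    #{x : ℂ | x ∈ U ∧ f x = z} = Cardinal.continuum}

/-- An uncountable Borel subset of a Polish space contains a nonempty perfect set. -/
lemma exists_perfect_subset_of_measurableSet {α : Type*} [TopologicalSpace α] [PolishSpace α]
    [MeasurableSpace α] [BorelSpace α] {B : Set α} (hB : MeasurableSet B) (hc : ¬ B.Countable) :
    ∃ S ⊆ B, Perfect S ∧ S.Nonempty := by
  obtain ⟨f, hfB, hf, hinj⟩ : ∃ f : (ℕ → Bool) → α,
      Set.range f ⊆ B ∧ Continuous f ∧ Function.Injective f := by
    obtain ⟨t', hle, hpol, hcl, -⟩ := hB.isClopenable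
    obtain ⟨f, hfB, hf, hinj⟩ :=
      @IsClosed.exists_nat_bool_injection_of_not_countable α t' hpol B hcl hc
    exact ⟨f, hfB, continuous_le_rng hle hf, hinj⟩
  have hunc : ¬ Countable (ℕ → Bool) := by
    rw [← mk_le_aleph0_iff, not_le]
    simpa using aleph0_lt_continuum
  have hrange : ¬ (Set.range f).Countable := fun h =>
    hunc (Set.countable_univ_iff.1 (Set.countable_of_injective_of_countable_image (s := Set.univ)
        hinj.injOn (by rwa [Set.image_univ])))
  obtain ⟨S, hS, hne, hsub⟩ := exists_perfect_nonempty_of_isClosed_of_not_countable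
    (isCompact_range hf).isClosed hrange
  exact ⟨S, hsub.trans hfB, hS, hne⟩

/-- An uncountable Borel set has a measurable bijection with any uncountable standard Borel
space. -/
lemma nonempty_measurableEquiv_of_not_countable {X Z : Type*} [MeasurableSpace X]
    [StandardBorelSpace X] [MeasurableSpace Z] [StandardBorelSpace Z] [Uncountable Z]
    {B : Set X} (hB : MeasurableSet B) (hc : ¬ B.Countable) : Nonempty (B ≃ᵐ Z) := by
  have := hB.standardBorel
  exact ⟨PolishSpace.measurableEquivOfNotCountable hc (not_countable_iff.2 ‹_›)⟩

lemma mk_eq_continuum_of_measurableSet {X : Type} [MeasurableSpace X] [StandardBorelSpace X]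
    {B : Set X} (hB : MeasurableSet B) (hc : ¬ B.Countable) : #B = 𝔠 := by
  obtain ⟨e⟩ := nonempty_measurableEquiv_of_not_countable (Z := ℝ) hB hc
  rw [e.toEquiv.cardinal_eq, mk_real]

/-- An uncountable Borel set contains an uncountable Borel set which avoids any given set of
fewer than `𝔠` points. -/
lemma exists_measurableSet_disjoint_of_mk_lt {X : Type} [MeasurableSpace X]
    [StandardBorelSpace X] {B C : Set X} (hB : MeasurableSet B) (hc : ¬ B.Countable)
    (hC : #C < 𝔠) :
    ∃ B' ⊆ B, MeasurableSet B' ∧ ¬ B'.Countable ∧ Disjoint B' C := by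
  obtain ⟨e⟩ := nonempty_measurableEquiv_of_not_countable (Z := ℝ × ℝ) hB hc
  have hlt : #((fun x : B => (e x).1) '' (Subtype.val ⁻¹' C)) < #ℝ := by
    rw [mk_real]
    exact (mk_image_le.trans (mk_preimage_of_injective _ _ Subtype.val_injective)).trans_lt hC
  obtain ⟨t, ht⟩ : ∃ t : ℝ, t ∉ (fun x : B => (e x).1) '' (Subtype.val ⁻¹' C) := by
    by_contra! h
    rw [Set.eq_univ_of_forall h, mk_univ] at hlt
    exact hlt.false
  refine ⟨Subtype.val '' ((fun x : B => (e x).1) ⁻¹' {t}), by simp, ?_, ?_, ?_⟩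
  · exact hB.subtype_image ((measurable_fst.comp e.measurable) (measurableSet_singleton t))
  · intro h
    have h1 : ((fun s : ℝ => (e.symm (t, s) : X)) '' Set.univ).Countable :=
      h.mono (by rintro _ ⟨s, -, rfl⟩; exact ⟨e.symm (t, s), by simp, rfl⟩)
    have h2 := Set.countable_of_injective_of_countable_image (s := Set.univ)
      (fun a _ b _ hab => by simpa using Subtype.val_injective hab) h1
    exact not_countable_real h2
  · rw [Set.disjoint_left]
    rintro _ ⟨x, hx, rfl⟩ hxC
    exact ht ⟨x, hxC, hx⟩

/-- A function with `𝔠` many uncountable Borel fibres has a section whose range is a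
Marczewski null set: every uncountable Borel set contains an uncountable Borel set disjoint
from it. -/
lemma exists_section_marczewski_null {X Y : Type} [MeasurableSpace X] [StandardBorelSpace X]
    (hY : #Y ≤ 𝔠) (h : X → Y) (hm : ∀ y, MeasurableSet (h ⁻¹' {y}))
    (hu : ∀ y, ¬ (h ⁻¹' {y}).Countable) :
    ∃ g : Y → X, (∀ y, h (g y) = y) ∧ ∀ B : Set X, MeasurableSet B → ¬ B.Countable →
      ∃ B' ⊆ B, MeasurableSet B' ∧ ¬ B'.Countable ∧ Disjoint B' (Set.range g) := by
  classical
  have hI : #((ord 𝔠).ToType) = 𝔠 := by simp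
  have hIic (i : (ord 𝔠).ToType) : #(Set.Iic i) < 𝔠 := by
    have h1 : #(Set.Iio i) < 𝔠 := by
      have := mk_Iio_lt i (by simp)
      rwa [hI] at this
    rw [← Set.Iio_insert]
    exact (mk_insert_le).trans_lt
      (add_lt_of_lt aleph0_le_continuum h1 (one_lt_aleph0.trans aleph0_lt_continuum))
  obtain ⟨e⟩ : Nonempty (Y ↪ (ord 𝔠).ToType) := by
    rw [← Cardinal.le_def, hI]; exact hY
  obtain ⟨b⟩ : Nonempty ({B : Set X | MeasurableSet B} ↪ (ord 𝔠).ToType) := by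
    rw [← Cardinal.le_def, hI]
    obtain ⟨s, hs, hgen⟩ := MeasurableSpace.CountablyGenerated.isCountablyGenerated (α := X)
    subst hgen
    exact MeasurableSpace.cardinal_measurableSet_le_continuum
      (hs.le_aleph0.trans aleph0_le_continuum)
  have key (y : Y) : ∃ x ∈ h ⁻¹' {y}, ∀ B : {B : Set X | MeasurableSet B}, b B ≤ e y →
      (B.1 ∩ h ⁻¹' {y}).Countable → x ∉ B.1 := by
    by_contra! hcon
    have hsub : h ⁻¹' {y} ⊆ ⋃ B : (b ⁻¹' Set.Iic (e y) : Set _),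
        (if (B.1.1 ∩ h ⁻¹' {y}).Countable then B.1.1 ∩ h ⁻¹' {y} else ∅) := by
      intro x hx
      obtain ⟨B, hBe, hBc, hxB⟩ := hcon x hx
      refine Set.mem_iUnion.2 ⟨⟨B, hBe⟩, ?_⟩
      rw [if_pos hBc]
      exact ⟨hxB, hx⟩
    have h1 := (mk_le_mk_of_subset hsub).trans (mk_iUnion_le _)
    rw [mk_eq_continuum_of_measurableSet (hm y) (hu y)] at h1
    refine (h1.trans_lt (mul_lt_of_lt aleph0_le_continuum ?_ ?_)).false
    · exact (mk_preimage_of_injective _ _ b.injective).trans_lt (hIic _)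
    · refine lt_of_le_of_lt (ciSup_le' fun B => ?_) aleph0_lt_continuum
      split_ifs with hB
      · exact hB.le_aleph0
      · simp
  choose g hg hgB using key
  refine ⟨g, hg, fun B hB hc => ?_⟩
  by_cases hfib : ∃ y, ¬ (B ∩ h ⁻¹' {y}).Countable
  · obtain ⟨y, hy⟩ := hfib
    refine ⟨(B ∩ h ⁻¹' {y}) \ {g y}, fun x hx => hx.1.1,
      (hB.inter (hm y)).diff (measurableSet_singleton _), fun hcount => hy ?_, ?_⟩
    · exact (hcount.union (Set.countable_singleton (g y))).mono (by simp)
    · rw [Set.disjoint_left]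
      rintro _ ⟨⟨-, hx⟩, hne⟩ ⟨y', rfl⟩
      have : y' = y := (hg y').symm.trans hx
      exact hne (by rw [this]; rfl)
  · push Not at hfib
    obtain ⟨B', hsub, hB', hc', hdisj⟩ := exists_measurableSet_disjoint_of_mk_lt hB hc
      (C := g '' (e ⁻¹' Set.Iic (b ⟨B, hB⟩)))
      ((mk_image_le.trans (mk_preimage_of_injective _ _ e.injective)).trans_lt (hIic _))
    refine ⟨B', hsub, hB', hc', ?_⟩
    rw [Set.disjoint_left] at hdisj ⊢
    rintro _ hx ⟨y, rfl⟩
    refine hdisj hx ⟨y, ?_, rfl⟩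
    by_contra hlt
    exact hgB y ⟨B, hB⟩ (not_le.1 hlt).le (hfib y) (hsub hx)

/-- A family of `2 ^ 𝔠` functions which is independent in the sense that any finitely many
distinct members simultaneously take any prescribed values at `𝔠` many points. -/
lemma exists_independent_family : ∃ u : Set ℝ → ℝ → ℂ,
    ∀ (n : ℕ) (ξ : Fin n → Set ℝ), Function.Injective ξ → ∀ z : Fin n → ℂ,
      #{t : ℝ | ∀ i, u (ξ i) t = z i} = 𝔠 := by
  classical
  have hcard : #ℝ = #((Finset ℝ × (Finset ℝ →₀ ℂ)) × ℝ) := by simp [mk_real]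
  obtain ⟨b⟩ := Cardinal.eq.1 hcard
  refine ⟨fun A t => (b t).1.2 ((b t).1.1.filter (· ∈ A)), fun n ξ hξ z => ?_⟩
  have hsep (i j : Fin n) : ∃ r : ℝ, i ≠ j → ¬ (r ∈ ξ i ↔ r ∈ ξ j) := by
    by_cases hij : i = j
    · exact ⟨0, fun h => (h hij).elim⟩
    · by_contra! hcon
      exact hij (hξ (Set.ext fun r => (hcon r).2))
  choose r hr using hsep
  let F : Finset ℝ := Finset.univ.image fun p : Fin n × Fin n => r p.1 p.2
  have hinj : Function.Injective fun i => F.filter (· ∈ ξ i) := by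
    intro i j hij
    by_contra hne
    apply hr i j hne
    have hmem : r i j ∈ F := Finset.mem_image.2 ⟨(i, j), by simp, rfl⟩
    simpa [hmem] using Finset.ext_iff.1 hij (r i j)
  let φ : Finset ℝ →₀ ℂ := Finsupp.embDomain ⟨_, hinj⟩ (Finsupp.equivFunOnFinite.symm z)
  have hφ (i : Fin n) : φ (F.filter (· ∈ ξ i)) = z i :=
    (Finsupp.embDomain_apply_self ⟨_, hinj⟩ _ i).trans (by simp)
  refine le_antisymm ((mk_set_le _).trans mk_real.le) ?_
  rw [← mk_real]
  refine mk_le_of_injective (f := fun s : ℝ => ⟨b.symm ((F, φ), s), fun i => ?_⟩) ?_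
  · simpa using hφ i
  · intro s s' hs
    simpa using hs

/-- A polynomial over an algebraically closed field which is not constant takes every value. -/
lemma MvPolynomial.exists_eval_eq {K : Type*} [Field K] [IsAlgClosed K] {σ : Type*} [Finite σ]
    {P : MvPolynomial σ K} (hP : ∀ c, P ≠ C c) (z : K) : ∃ v : σ → K, eval v P = z := by
  by_contra! hcon
  have hrad := vanishingIdeal_zeroLocus_eq_radical (K := K) (Ideal.span {P - C z})
  have hempty : zeroLocus K (Ideal.span {P - C z}) = ∅ := by
    refine Set.eq_empty_of_forall_notMem fun v hv => hcon v ?_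
    have := mem_zeroLocus_iff.1 hv _ (Ideal.mem_span_singleton_self _)
    simpa [sub_eq_zero, aeval_eq_eval] using this
  have htop : Ideal.span {P - C z} = ⊤ := by
    rw [← Ideal.radical_eq_top, ← hrad, hempty]
    exact (Ideal.eq_top_iff_one _).2 fun x hx => hx.elim
  obtain ⟨r, -, hr⟩ := isUnit_iff_eq_C_of_isReduced.1 (Ideal.span_singleton_eq_top.1 htop)
  exact hP (r + z) (by rw [C_add, ← hr]; ring)

/-- There are disjoint measurable copies of the plane, each lying in a horizontal line of `ℂ`,
such that every nonempty open set contains one of them. -/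
lemma exists_measurable_injective_into_lines : ∃ Φ : ℕ × (ℝ × ℝ) → ℂ,
    Measurable Φ ∧ Function.Injective Φ ∧ (∃ c : ℕ → ℝ, ∀ p, (Φ p).im = c p.1) ∧
    ∀ U : Set ℂ, IsOpen U → U.Nonempty → ∃ n, ∀ p, Φ (n, p) ∈ U := by
  obtain ⟨b, hbc, hbe, hb⟩ := TopologicalSpace.exists_countable_basis ℂ
  have hbne : b.Nonempty := by
    obtain ⟨v, hv, -⟩ := hb.exists_subset_of_mem_open (Set.mem_univ (0 : ℂ)) isOpen_univ
    exact ⟨v, hv⟩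
  obtain ⟨V, rfl⟩ := hbc.exists_eq_range hbne
  have hseg (n : ℕ) : ∃ (x r : ℝ) (q : ℚ), 0 < r ∧ ∀ t ∈ Set.Ioo (0 : ℝ) 1,
      (⟨x + r * t, q + n * √2⟩ : ℂ) ∈ V n := by
    obtain ⟨z, hz⟩ : (V n).Nonempty := Set.nonempty_iff_ne_empty.2 fun h => hbe ⟨n, h⟩
    obtain ⟨ε, hε, hball⟩ := Metric.isOpen_iff.1 (hb.isOpen ⟨n, rfl⟩) z hz
    obtain ⟨q, hq1, hq2⟩ := exists_rat_btwn
      (show z.im - n * √2 < z.im - n * √2 + ε / 2 by linarith)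
    refine ⟨z.re, ε / 2, q, by positivity, fun t ht => hball ?_⟩
    rw [Metric.mem_ball, dist_eq_norm]
    refine (Complex.norm_le_abs_re_add_abs_im _).trans_lt ?_
    have h1 : 0 < ε / 2 * t := mul_pos (by positivity) ht.1
    have h2 : ε / 2 * t < ε / 2 := mul_lt_of_lt_one_right (by positivity) ht.2
    simp only [Complex.sub_re, Complex.sub_im, add_sub_cancel_left]
    rw [abs_of_pos h1, abs_of_pos (by linarith)]
    linarith
  choose x r q hr hV using hseg
  have hIoo : ¬ (Set.Ioo (0 : ℝ) 1).Countable := by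
    rw [← le_aleph0_iff_set_countable, mk_Ioo_real one_pos, not_le]
    exact aleph0_lt_continuum
  obtain ⟨e⟩ := nonempty_measurableEquiv_of_not_countable (Z := ℝ × ℝ) measurableSet_Ioo hIoo
  refine ⟨fun p => ⟨x p.1 + r p.1 * (e.symm p.2 : ℝ), q p.1 + p.1 * √2⟩, ?_, ?_,
    ⟨fun n => q n + n * √2, fun p => rfl⟩, fun U hU ⟨z, hz⟩ => ?_⟩
  · refine measurable_from_prod_countable_right fun n => ?_
    have h : Measurable fun p : ℝ × ℝ => (x n + r n * (e.symm p : ℝ), q n + n * √2) :=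
      ((measurable_subtype_coe.comp e.symm.measurable).const_mul _ |>.const_add _).prodMk
        measurable_const
    exact Complex.measurableEquivRealProd.symm.measurable.comp h
  · rintro ⟨n, p⟩ ⟨m, p'⟩ h
    have him := congrArg Complex.im h
    have hre := congrArg Complex.re h
    simp only at him hre
    obtain rfl : n = m := by
      by_contra hne
      have hne' : ((n : ℚ) - m) ≠ 0 := sub_ne_zero.2 (by exact_mod_cast hne)
      refine irrational_sqrt_two ⟨(q m - q n) / (n - m), ?_⟩
      have hne'' : ((n : ℝ) - m) ≠ 0 := by exact_mod_cast hne'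
      push_cast
      rw [div_eq_iff hne'']
      linarith
    have := e.symm.injective (Subtype.val_injective
      (mul_left_cancel₀ (hr n).ne' (add_left_cancel hre)))
    rw [this]
  · obtain ⟨_, ⟨n, rfl⟩, -, hsub⟩ := hb.exists_subset_of_mem_open hz hU
    exact ⟨n, fun p => hsub (hV n _ (e.symm p).2)⟩

/-- There is a Marczewski null set which is contained in a countable union of horizontal lines
and has `𝔠` many points in every nonempty open set. -/
lemma exists_dense_marczewski_null : ∃ d : ℕ × ℝ → ℂ,
    Function.Injective d ∧ (∃ c : ℕ → ℝ, ∀ p, (d p).im = c p.1) ∧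
    (∀ U : Set ℂ, IsOpen U → U.Nonempty → ∃ n, ∀ t, d (n, t) ∈ U) ∧
    ∀ B : Set ℂ, MeasurableSet B → ¬ B.Countable →
      ∃ B' ⊆ B, MeasurableSet B' ∧ ¬ B'.Countable ∧ Disjoint B' (Set.range d) := by
  obtain ⟨Φ, hm, hinj, ⟨c, hc⟩, hU⟩ := exists_measurable_injective_into_lines
  have hproj : Measurable fun p : ℕ × (ℝ × ℝ) => (p.1, p.2.1) := by fun_prop
  obtain ⟨g, hg, hgB⟩ := exists_section_marczewski_null (Y := ℕ × ℝ) (by simp [mk_real])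
    (fun p : ℕ × (ℝ × ℝ) => (p.1, p.2.1)) (fun y => hproj (measurableSet_singleton y))
    (fun y hy => not_countable_real <| by
      refine Set.countable_of_injective_of_countable_image
        (f := fun s : ℝ => (y.1, y.2, s)) (fun a _ b _ hab => by simpa using hab) (hy.mono ?_)
      rintro _ ⟨s, -, rfl⟩
      rfl)
  have hg1 (p) : (g p).1 = p.1 := congrArg Prod.fst (hg p)
  have hginj : Function.Injective g :=
    Function.LeftInverse.injective (g := fun p : ℕ × (ℝ × ℝ) => (p.1, p.2.1)) hg
  refine ⟨Φ ∘ g, hinj.comp hginj, ⟨c, fun p => ?_⟩, fun U hUo hne => ?_, fun B hB hBc => ?_⟩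
  · rw [Function.comp_apply, hc, hg1]
  · obtain ⟨n, hn⟩ := hU U hUo hne
    refine ⟨n, fun t => ?_⟩
    have h := hn (g (n, t)).2
    have h1 : n = (g (n, t)).1 := (hg1 (n, t)).symm
    rw [Function.comp_apply]
    nth_rewrite 1 [h1] at h
    exact h
  · by_cases hpre : (Φ ⁻¹' B).Countable
    · refine ⟨B \ Set.range Φ, Set.sdiff_subset, hB.diff ?_, fun h => hBc ?_, ?_⟩
      · rw [← Set.image_univ]
        exact MeasurableSet.univ.image_of_measurable_injOn hm hinj.injOn
      · refine (h.union (hpre.image Φ)).mono fun x hx => ?_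
        by_cases hxr : x ∈ Set.range Φ
        · obtain ⟨p, rfl⟩ := hxr
          exact Or.inr ⟨p, hx, rfl⟩
        · exact Or.inl ⟨hx, hxr⟩
      · exact Set.disjoint_sdiff_left.mono_right (Set.range_comp_subset_range g Φ)
    · obtain ⟨B', hsub, hB', hc', hdisj⟩ := hgB _ (hm hB) hpre
      refine ⟨Φ '' B', Set.image_subset_iff.2 hsub,
        hB'.image_of_measurable_injOn hm hinj.injOn,
        fun h => hc' (Set.countable_of_injective_of_countable_image hinj.injOn h), ?_⟩
      rw [Set.range_comp]
      exact (Set.disjoint_image_iff hinj).2 hdisj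

lemma isMeagre_im_preimage_range (c : ℕ → ℝ) : IsMeagre (Complex.im ⁻¹' Set.range c) := by
  rw [← Set.iUnion_singleton_eq_range, Set.preimage_iUnion]
  refine isMeagre_iUnion fun n => IsNowhereDense.isMeagre ?_
  rw [(isClosed_singleton.preimage Complex.continuous_im).isNowhereDense_iff,
    ← Complex.isOpenMap_im.preimage_interior_eq_interior_preimage Complex.continuous_im]
  simp

lemma volume_im_preimage_range (c : ℕ → ℝ) :
    MeasureTheory.volume (Complex.im ⁻¹' Set.range c) = 0 := by
  rw [← Set.iUnion_singleton_eq_range, Set.preimage_iUnion, MeasureTheory.measure_iUnion_null_iff]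
  intro n
  have h : Complex.im ⁻¹' {c n} =
      Complex.measurableEquivRealProd ⁻¹' (Set.univ ×ˢ {c n}) := by
    ext z; simp [Complex.measurableEquivRealProd_apply]
  rw [h, Complex.volume_preserving_equiv_real_prod.measure_preimage
    (MeasurableSet.univ.prod (measurableSet_singleton _)).nullMeasurableSet,
    MeasureTheory.Measure.volume_eq_prod, MeasureTheory.Measure.prod_prod]
  simp

/-- A function vanishing off a meagre set has the Baire property. -/
lemma hasBaireProperty_preimage_of_isMeagre {X Z : Type} [TopologicalSpace X] [Zero Z] {M : Set X}
    (hM : IsMeagre M) {f : X → Z} (hf : ∀ x ∉ M, f x = 0) (V : Set Z) :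
    HasBaireProperty (f ⁻¹' V) := by
  by_cases h0 : (0 : Z) ∈ V
  · refine ⟨Set.univ, isOpen_univ, hM.mono ?_⟩
    rintro x (⟨-, hx⟩ | ⟨-, hx⟩)
    · exact (hx trivial).elim
    · by_contra hxM
      exact hx (by rwa [Set.mem_preimage, hf x hxM])
  · refine ⟨∅, isOpen_empty, hM.mono ?_⟩
    rintro x (⟨hx, -⟩ | ⟨hx, -⟩)
    · by_contra hxM
      rw [Set.mem_preimage, hf x hxM] at hx
      exact h0 hx
    · exact hx.elim

/-- The set `𝓖` of all `f : ℂ → ℂ` which are (a) strongly everywhere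
surjective, (b) vanish identically on some nonempty perfect subset of every nonempty perfect
set, and (c) are Lebesgue measurable and have the Baire property, is strongly
`2 ^ 𝔠`-algebrable in `ℂ^ℂ`. -/
theorem stmt13 :
    StronglyAlgebrable ℂ
      {f : ℂ → ℂ | f ∈ SES ∧
        (∀ S : Set ℂ, Perfect S → S.Nonempty →
          ∃ S' : Set ℂ, S' ⊆ S ∧ Perfect S' ∧ S'.Nonempty ∧ ∀ x ∈ S', f x = 0) ∧
        MeasureTheory.NullMeasurable f MeasureTheory.volume ∧
        (∀ V : Set ℂ, IsOpen V → HasBaireProperty (f ⁻¹' V))}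
      ((2 : Cardinal) ^ Cardinal.continuum) := by
  set E : Set (ℂ → ℂ) := {f : ℂ → ℂ | f ∈ SES ∧
    (∀ S : Set ℂ, Perfect S → S.Nonempty →
      ∃ S' : Set ℂ, S' ⊆ S ∧ Perfect S' ∧ S'.Nonempty ∧ ∀ x ∈ S', f x = 0) ∧
    MeasureTheory.NullMeasurable f MeasureTheory.volume ∧
    (∀ V : Set ℂ, IsOpen V → HasBaireProperty (f ⁻¹' V))}
  obtain ⟨d, hd, ⟨c, hc⟩, hU, hB⟩ := exists_dense_marczewski_null
  obtain ⟨u, hu⟩ := exists_independent_family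
  have hmem {f : ℂ → ℂ} {G : ℝ → ℂ} (hG : ∀ z, #{t : ℝ | G t = z} = 𝔠)
      (hfd : ∀ p, f (d p) = G p.2) (hf0 : ∀ w ∉ Set.range d, f w = 0) :
      f ∈ E := by
    have hf0' : ∀ w ∉ Complex.im ⁻¹' Set.range c, f w = 0 := by
      intro w hw
      refine hf0 w ?_
      rintro ⟨p, rfl⟩
      exact hw ⟨p.1, (hc p).symm⟩
    refine ⟨fun U hUo hne z => ?_, fun S hS hne => ?_, ?_, fun V _ =>
      hasBaireProperty_preimage_of_isMeagre (isMeagre_im_preimage_range c) hf0' V⟩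
    · refine le_antisymm ((mk_set_le _).trans mk_complex.le) ?_
      obtain ⟨n, hn⟩ := hU U hUo hne
      rw [← hG z]
      refine mk_le_of_injective
        (f := fun t : {t : ℝ | G t = z} => ⟨d (n, t), hn t, (hfd _).trans t.2⟩) ?_
      intro t t' h
      have := hd (Subtype.mk.inj h)
      exact Subtype.ext (Prod.mk.inj this).2
    · have hSc : ¬ S.Countable := by
        intro hcount
        obtain ⟨i, hi, -, hinj⟩ := hS.exists_nat_bool_injection hne
        have h : (Set.univ : Set (ℕ → Bool)).Countable :=
          Set.countable_of_injective_of_countable_image hinj.injOn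
            (hcount.mono (by rwa [Set.image_univ]))
        rw [← le_aleph0_iff_set_countable] at h
        simp at h
        exact (aleph0_lt_continuum.trans_le h).false
      obtain ⟨B', hsub, hB', hc', hdisj⟩ := hB S hS.closed.measurableSet hSc
      obtain ⟨S', hsub', hS', hne'⟩ := exists_perfect_subset_of_measurableSet hB' hc'
      exact ⟨S', hsub'.trans hsub, hS', hne', fun x hx =>
        hf0 x (Set.disjoint_left.1 hdisj (hsub' hx))⟩
    · refine AEMeasurable.nullMeasurable ⟨fun _ => 0, measurable_const, ?_⟩
      refine MeasureTheory.measure_mono_null (fun w hw => ?_) (volume_im_preimage_range c)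
      by_contra hw'
      exact hw (hf0' w hw')
  let x : Set ℝ → ℂ → ℂ := fun A => Function.extend d (fun p => u A p.2) 0
  have hP (n : ℕ) (P : MvPolynomial (Fin n) ℂ) (hP0 : P ≠ 0)
      (hPc : MvPolynomial.constantCoeff P = 0) (ξ : Fin n → Set ℝ) (hξ : Function.Injective ξ) :
      MvPolynomial.aeval (fun i => x (ξ i)) P ∈ E := by
    have hev (w : ℂ) : MvPolynomial.aeval (fun i => x (ξ i)) P w =
        MvPolynomial.eval (fun i => x (ξ i) w) P :=
      MvPolynomial.map_aeval (fun i => x (ξ i)) (Pi.evalRingHom (fun _ => ℂ) w) P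
    refine hmem (G := fun t => MvPolynomial.eval (fun i => u (ξ i) t) P) (fun z => ?_)
      (fun p => ?_) (fun w hw => ?_)
    · obtain ⟨v, hv⟩ := MvPolynomial.exists_eval_eq (P := P)
        (fun a ha => hP0 (by rw [ha, MvPolynomial.constantCoeff_C] at hPc; rw [ha, hPc, map_zero]))
        z
      refine le_antisymm ((mk_set_le _).trans mk_real.le) ?_
      rw [← hu n ξ hξ v]
      refine mk_le_mk_of_subset fun t ht => ?_
      rw [← hv]
      exact congrArg (fun s => MvPolynomial.eval s P) (funext ht)
    · rw [hev]
      simp only [x, hd.extend_apply]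
    · rw [hev]
      have h0 : (fun i => x (ξ i) w) = 0 := by
        funext i
        exact Function.extend_apply' _ _ _ hw
      rw [h0, ← hPc, MvPolynomial.constantCoeff_eq, MvPolynomial.eval_zero]
      rfl
  have hne {f : ℂ → ℂ} (hf : f ∈ SES) : f ≠ 0 := by
    rintro rfl
    have h := hf Set.univ isOpen_univ Set.univ_nonempty 1
    simp at h
    exact continuum_ne_zero h.symm
  refine ⟨Set ℝ, x, by simp [mk_real], fun A A' hAA' => ?_, fun A => ?_,
    fun n _ P hP0 hPc ξ hξ => ⟨hne (hP n P hP0 hPc ξ hξ).1, hP n P hP0 hPc ξ hξ⟩⟩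
  · by_contra hAne
    have hX : (MvPolynomial.X 0 - MvPolynomial.X 1 : MvPolynomial (Fin 2) ℂ) ≠ 0 :=
      sub_ne_zero.2 fun h => by simpa using MvPolynomial.X_injective h
    refine hne (hP 2 _ hX (by simp) ![A, A'] ?_).1 (by simp [hAA'])
    intro i j
    fin_cases i <;> fin_cases j <;> simp [hAne, Ne.symm hAne]
  · simpa using hP 1 (MvPolynomial.X 0) (MvPolynomial.X_ne_zero 0) (by simp) (fun _ => A)
      (Function.injective_of_subsingleton _)
end
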